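/- Let p ≡ 1 (mod 3) be prime and let q, r be integers coprime to p. Let ν be the number of elements of {q, r, qr} that are cubes in F_p^*. Then the number of projective points over F_p on the surface X0^3 + q^2 X1^3 + q r X2^3 + r^2 X3^3 = 0 equals p^2 + (3ν - 2)p + 1. -/

import Mathlib

open Classical

/-- The cubic exponential sum. -/
noncomputable def cubS (p : ℕ) [Fact p.Prime] (a : ZMod p) : ℂ :=
  ∑ x : ZMod p, ZMod.stdAddChar (a * x ^ 3)

lemma cubS_zero (p : ℕ) [Fact p.Prime] : cubS p 0 = p := by
  simp [cubS, ZMod.card]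

lemma cubS_mul_cube (p : ℕ) [Fact p.Prime] (a c : ZMod p) (hc : c ≠ 0) :
    cubS p (a * c ^ 3) = cubS p a := by
  unfold cubS
  refine Fintype.sum_equiv (Equiv.mulLeft₀ c hc) _ _ fun x => ?_
  simp only [Equiv.mulLeft₀_apply]
  congr 1
  ring

lemma stdAddChar_sum (p : ℕ) [Fact p.Prime] (n : ℕ) (f : Fin n → ZMod p) :
    (ZMod.stdAddChar (∑ i, f i) : ℂ) = ∏ i, (ZMod.stdAddChar (f i) : ℂ) := by
  induction n with
  | zero => simp
  | succ n ih => rw [Fin.sum_univ_succ, Fin.prod_univ_succ, AddChar.map_add_eq_mul, ih]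

lemma card_eq_sum (p : ℕ) [Fact p.Prime] (n : ℕ) (a : Fin n → ZMod p) :
    (p : ℂ) * (Nat.card {x : Fin n → ZMod p // ∑ i, a i * x i ^ 3 = 0} : ℂ)
      = ∑ t : ZMod p, ∏ i, cubS p (t * a i) := by
  have h1 : ∀ t : ZMod p, ∏ i, cubS p (t * a i)
      = ∑ x : Fin n → ZMod p, ZMod.stdAddChar (t * ∑ i, a i * x i ^ 3) := by
    intro t
    unfold cubS
    rw [Finset.prod_univ_sum]
    simp only [Fintype.piFinset_univ]
    refine Finset.sum_congr rfl fun x _ => ?_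
    rw [Finset.mul_sum, stdAddChar_sum]
    refine Finset.prod_congr rfl fun i _ => ?_
    rw [mul_assoc]
  simp_rw [h1]
  rw [Finset.sum_comm]
  have h2 : ∀ b : ZMod p, ∑ t : ZMod p, (ZMod.stdAddChar (t * b) : ℂ)
      = if b = 0 then (p : ℂ) else 0 := by
    intro b
    rw [AddChar.sum_mulShift b (ZMod.isPrimitive_stdAddChar p)]
    split_ifs <;> simp [ZMod.card]
  simp_rw [h2]
  rw [← Finset.sum_filter, Finset.sum_const, Nat.card_eq_fintype_card, Fintype.card_subtype,
    nsmul_eq_mul, mul_comm]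

lemma exists_gen (p : ℕ) [Fact p.Prime] :
    ∃ g : (ZMod p)ˣ, (∀ y : (ZMod p)ˣ, ∃ n : ℕ, g ^ n = y) ∧ orderOf g = p - 1 := by
  obtain ⟨g, hg⟩ := IsCyclic.exists_monoid_generator (α := (ZMod p)ˣ)
  refine ⟨g, fun y => hg y, ?_⟩
  rw [orderOf_eq_card_of_forall_mem_zpowers fun x => mem_powers_iff_mem_zpowers.1 (hg x)]
  rw [Nat.card_eq_fintype_card, ZMod.card_units]

lemma cube_iff (p : ℕ) [Fact p.Prime] (hp3 : p % 3 = 1) (g : (ZMod p)ˣ)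
    (hg : ∀ y : (ZMod p)ˣ, ∃ n : ℕ, g ^ n = y) (ho : orderOf g = p - 1) (i : ℕ) :
    (∃ u : (ZMod p)ˣ, (u : ZMod p) ^ 3 = (g : ZMod p) ^ i) ↔ i % 3 = 0 := by
  constructor
  · rintro ⟨u, hu⟩
    obtain ⟨n, rfl⟩ := hg u
    have h : (g ^ n) ^ 3 = g ^ i := by ext; simpa using hu
    rw [← pow_mul, pow_eq_pow_iff_modEq, ho] at h
    have h3 : 3 ∣ p - 1 := by omega
    have := h.of_dvd h3
    unfold Nat.ModEq at this
    omega
  · intro h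
    refine ⟨g ^ (i / 3), ?_⟩
    rw [Units.val_pow_eq_pow_val, ← pow_mul]
    congr 1
    omega

lemma sum_split (p : ℕ) [Fact p.Prime] (g : (ZMod p)ˣ)
    (hg : ∀ y : (ZMod p)ˣ, ∃ n : ℕ, g ^ n = y) (f : ZMod p → ℂ)
    (hf : ∀ n : ℕ, f ((g : ZMod p) ^ (n + 3)) = f ((g : ZMod p) ^ n)) :
    3 * ∑ t : ZMod p, f t = 3 * f 0 +
      ((p : ℂ) - 1) * (f ((g : ZMod p) ^ 0) + f ((g : ZMod p) ^ 1) + f ((g : ZMod p) ^ 2)) := by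
  have hp1 : 1 ≤ p := (Fact.out : p.Prime).one_le
  have h0 : ∑ t : ZMod p, f t = f 0 + ∑ u : (ZMod p)ˣ, f u := by
    rw [← Finset.add_sum_erase _ _ (Finset.mem_univ (0 : ZMod p))]
    congr 1
    symm
    refine Finset.sum_bij (fun u _ => (u : ZMod p)) ?_ ?_ ?_ ?_
    · intro u _; simp
    · intro u _ v _ h; exact Units.ext h
    · intro b hb
      exact ⟨Units.mk0 b (by simpa using hb), Finset.mem_univ _, rfl⟩
    · intro u _; rfl
  have hs : ∀ k : ℕ, ∑ u : (ZMod p)ˣ, f u = ∑ u : (ZMod p)ˣ, f ((g ^ k * u : (ZMod p)ˣ)) := by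
    intro k
    exact (Fintype.sum_equiv (Equiv.mulLeft (g ^ k)) _ _ fun x => rfl).symm
  have hc : ∀ u : (ZMod p)ˣ, f ((g ^ 0 * u : (ZMod p)ˣ)) + f ((g ^ 1 * u : (ZMod p)ˣ))
      + f ((g ^ 2 * u : (ZMod p)ˣ))
      = f ((g : ZMod p) ^ 0) + f ((g : ZMod p) ^ 1) + f ((g : ZMod p) ^ 2) := by
    intro u
    obtain ⟨n, rfl⟩ := hg u
    simp only [← pow_add, Units.val_pow_eq_pow_val]
    induction n with
    | zero => simp
    | succ n ih =>
      rw [← ih, show 2 + (n + 1) = n + 3 by ring, hf, show 0 + (n + 1) = 1 + n by ring,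
        show 1 + (n + 1) = 2 + n by ring, show 0 + n = n by ring]
      ring
  have h3 : 3 * ∑ u : (ZMod p)ˣ, f u = ((p : ℂ) - 1) *
      (f ((g : ZMod p) ^ 0) + f ((g : ZMod p) ^ 1) + f ((g : ZMod p) ^ 2)) := by
    calc 3 * ∑ u : (ZMod p)ˣ, f u
        = ∑ u : (ZMod p)ˣ, f u + ∑ u : (ZMod p)ˣ, f u + ∑ u : (ZMod p)ˣ, f u := by ring
      _ = ∑ u : (ZMod p)ˣ, f ((g ^ 0 * u : (ZMod p)ˣ)) + ∑ u : (ZMod p)ˣ, f ((g ^ 1 * u : (ZMod p)ˣ))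
          + ∑ u : (ZMod p)ˣ, f ((g ^ 2 * u : (ZMod p)ˣ)) := by
            rw [← hs 0, ← hs 1, ← hs 2]
      _ = _ := by
            rw [← Finset.sum_add_distrib, ← Finset.sum_add_distrib, Finset.sum_congr rfl fun u _ => hc u,
              Finset.sum_const, Finset.card_univ, ZMod.card_units, nsmul_eq_mul]
            push_cast [hp1]
            ring
  rw [h0, mul_add, h3]

lemma card_two (p : ℕ) [Fact p.Prime] (hp3 : p % 3 = 1) (g : (ZMod p)ˣ) (ho : orderOf g = p - 1) :
    Nat.card {x : Fin 2 → ZMod p // ∑ i, (1 : ZMod p) * x i ^ 3 = 0} = 1 + 3 * (p - 1) := by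
  have hp2 : 2 ≤ p := (Fact.out : p.Prime).two_le
  obtain ⟨w, hw⟩ : ∃ w : ZMod p, w ^ 2 + w + 1 = 0 := by
    refine ⟨(g : ZMod p) ^ ((p - 1) / 3), ?_⟩
    set w := (g : ZMod p) ^ ((p - 1) / 3) with hwdef
    have h3 : w ^ 3 = 1 := by
      rw [hwdef, ← pow_mul, show (p - 1) / 3 * 3 = p - 1 by omega]
      exact ZMod.pow_card_sub_one_eq_one g.ne_zero
    have h1 : w - 1 ≠ 0 := by
      intro h
      have h' : g ^ ((p - 1) / 3) = 1 := by
        ext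
        rw [Units.val_pow_eq_pow_val, ← hwdef]
        exact sub_eq_zero.1 h
      have := Nat.le_of_dvd (by omega) (ho ▸ orderOf_dvd_of_pow_eq_one h')
      omega
    apply mul_left_cancel₀ h1
    linear_combination h3
  have h3 : (3 : ZMod p) ≠ 0 := by
    intro h
    have : ((3 : ℕ) : ZMod p) = 0 := by exact_mod_cast h
    rw [ZMod.natCast_eq_zero_iff] at this
    have := (Nat.prime_dvd_prime_iff_eq Fact.out Nat.prime_three).1 this
    omega
  have hw1 : w ≠ 1 := by
    rintro rfl; apply h3; linear_combination hw
  have hw0 : w ≠ 0 := by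
    rintro rfl; simp at hw
  have hww : w ^ 2 ≠ w := by
    intro h; apply hw1; apply mul_left_cancel₀ hw0; linear_combination h
  have hww1 : w ^ 2 ≠ 1 := by
    intro h; apply hww; linear_combination (1 + w) * h - (w-1) * hw
  have key : ∀ y : ZMod p, (Finset.univ.filter fun x : ZMod p => y ^ 3 + x ^ 3 = 0).card
      = if y = 0 then 1 else 3 := by
    intro y
    split_ifs with hy
    · subst hy
      rw [Finset.card_eq_one]
      refine ⟨0, ?_⟩
      ext x; simp
    · have : (Finset.univ.filter fun x : ZMod p => y ^ 3 + x ^ 3 = 0)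
          = {-y, -(w * y), -(w ^ 2 * y)} := by
        ext x
        simp only [Finset.mem_filter, Finset.mem_univ, true_and, Finset.mem_insert,
          Finset.mem_singleton]
        have : y ^ 3 + x ^ 3 = (x + y) * ((x + w * y) * (x + w ^ 2 * y)) := by
          linear_combination (-(x+y)*x*y-(x + y) * y ^2 * (w-1)) * hw
        rw [this, mul_eq_zero, mul_eq_zero, add_eq_zero_iff_eq_neg, add_eq_zero_iff_eq_neg,
          add_eq_zero_iff_eq_neg]
      rw [this, Finset.card_eq_three]
      refine ⟨_, _, _, ?_, ?_, ?_, rfl⟩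
      · intro h; apply hw1; apply mul_right_cancel₀ hy; linear_combination h
      · intro h; apply hww1; apply mul_right_cancel₀ hy; linear_combination h
      · intro h; apply hww; apply mul_right_cancel₀ hy; linear_combination h
  have e : {x : Fin 2 → ZMod p // ∑ i, (1 : ZMod p) * x i ^ 3 = 0} ≃
      (Σ y : ZMod p, {x : ZMod p // y ^ 3 + x ^ 3 = 0}) :=
    { toFun := fun x => ⟨x.1 0, x.1 1, by simpa [Fin.sum_univ_two] using x.2⟩
      invFun := fun z => ⟨![z.1, z.2.1], by simpa [Fin.sum_univ_two] using z.2.2⟩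
      left_inv := by
        rintro ⟨x, hx⟩
        ext i
        fin_cases i <;> rfl
      right_inv := by
        rintro ⟨y, x, hx⟩
        rfl }
  rw [Nat.card_congr e, Nat.card_eq_fintype_card, Fintype.card_sigma]
  simp_rw [Fintype.card_subtype, key]
  rw [← Finset.add_sum_erase _ _ (Finset.mem_univ (0 : ZMod p)), if_pos rfl,
    Finset.sum_congr rfl fun y hy => if_neg (Finset.ne_of_mem_erase hy), Finset.sum_const,
    Finset.card_erase_of_mem (Finset.mem_univ _), Finset.card_univ, ZMod.card, smul_eq_mul, mul_comm]

lemma proj_card (p : ℕ) [Fact p.Prime] (a : Fin 4 → ZMod p) :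
    Nat.card {x : Fin 4 → ZMod p // ∑ i, a i * x i ^ 3 = 0} =
    Nat.card {P : Projectivization (ZMod p) (Fin 4 → ZMod p) // ∑ i, a i * P.rep i ^ 3 = 0}
      * (p - 1) + 1 := by
  have hsm : ∀ (c : ZMod p) (v : Fin 4 → ZMod p),
      ∑ i, a i * (c • v) i ^ 3 = c ^ 3 * ∑ i, a i * v i ^ 3 := by
    intro c v
    rw [Finset.mul_sum]
    refine Finset.sum_congr rfl fun i _ => ?_
    simp only [Pi.smul_apply, smul_eq_mul]
    ring
  let F : Option ({P : Projectivization (ZMod p) (Fin 4 → ZMod p) //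
      ∑ i, a i * P.rep i ^ 3 = 0} × (ZMod p)ˣ) → {x : Fin 4 → ZMod p // ∑ i, a i * x i ^ 3 = 0} :=
    fun o => o.elim ⟨0, by simp⟩ fun z => ⟨(z.2 : ZMod p) • z.1.1.rep, by rw [hsm, z.1.2, mul_zero]⟩
  have hne : ∀ (P : Projectivization (ZMod p) (Fin 4 → ZMod p)) (u : (ZMod p)ˣ),
      (u : ZMod p) • P.rep ≠ 0 := fun P u => smul_ne_zero u.ne_zero P.rep_nonzero
  have hF : Function.Bijective F := by
    constructor
    · rintro (_ | ⟨⟨P, hP⟩, u⟩) (_ | ⟨⟨Q, hQ⟩, v⟩) h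
      · rfl
      · exact absurd (congrArg Subtype.val h).symm (hne Q v)
      · exact absurd (congrArg Subtype.val h) (hne P u)
      · have h' : (u : ZMod p) • P.rep = (v : ZMod p) • Q.rep := congrArg Subtype.val h
        have hPQ : P = Q := by
          rw [← P.mk_rep, ← Q.mk_rep, Projectivization.mk_eq_mk_iff]
          refine ⟨u⁻¹ * v, ?_⟩
          rw [mul_smul, inv_smul_eq_iff]
          exact h'.symm
        subst hPQ
        have huv : u = v := Units.ext (smul_left_injective _ P.rep_nonzero h')
        subst huv
        rfl
    · rintro ⟨x, hx⟩
      by_cases h0 : x = 0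
      · subst h0
        exact ⟨none, rfl⟩
      · obtain ⟨u, hu⟩ := Projectivization.exists_smul_eq_mk_rep (ZMod p) x h0
        refine ⟨some ⟨⟨Projectivization.mk (ZMod p) x h0, ?_⟩, u⁻¹⟩, ?_⟩
        · rw [← hu, Units.smul_def, hsm, hx, mul_zero]
        · apply Subtype.ext
          change ((u⁻¹ : (ZMod p)ˣ) : ZMod p) • (Projectivization.mk (ZMod p) x h0).rep = x
          rw [← Units.smul_def, ← hu, inv_smul_smul]
  rw [← Nat.card_congr (Equiv.ofBijective F hF), Finite.card_option, Nat.card_prod,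
    Nat.card_eq_fintype_card (α := (ZMod p)ˣ), ZMod.card_units]

/-- Let `p ≡ 1 (mod 3)` be prime and `q, r` integers coprime to `p`.  Let `ν` be the
number of elements of `{q, r, qr}` that are cubes in `𝔽_p^*`.  Then the number of
projective points over `𝔽_p` on the surface `X₀³ + q² X₁³ + q r X₂³ + r² X₃³ = 0`
equals `p² + (3ν - 2)p + 1`. -/
theorem count_projective_diagonal_cubic_one_mod_three (p : ℕ) (hp : p.Prime)
    [Fact p.Prime] (hp3 : p % 3 = 1) (q r : ℤ) (hq : ¬ (p : ℤ) ∣ q) (hr : ¬ (p : ℤ) ∣ r)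
    (ν : ℕ)
    (hν : (ν : ℤ) =
      (if ∃ u : (ZMod p)ˣ, (u : ZMod p) ^ 3 = (q : ZMod p) then 1 else 0)
      + (if ∃ u : (ZMod p)ˣ, (u : ZMod p) ^ 3 = (r : ZMod p) then 1 else 0)
      + (if ∃ u : (ZMod p)ˣ, (u : ZMod p) ^ 3 = ((q * r : ℤ) : ZMod p) then 1 else 0)) :
    (Nat.card {P : Projectivization (ZMod p) (Fin 4 → ZMod p) //
        (P.rep 0) ^ 3 + ((q : ZMod p)) ^ 2 * (P.rep 1) ^ 3
          + (q : ZMod p) * (r : ZMod p) * (P.rep 2) ^ 3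
          + ((r : ZMod p)) ^ 2 * (P.rep 3) ^ 3 = 0} : ℤ) =
    (p : ℤ) ^ 2 + (3 * (ν : ℤ) - 2) * p + 1 := by
  have hp2 : 2 ≤ p := hp.two_le
  obtain ⟨g, hg, ho⟩ := exists_gen p
  have hq0 : (q : ZMod p) ≠ 0 := by rwa [Ne, ZMod.intCast_zmod_eq_zero_iff_dvd]
  have hr0 : (r : ZMod p) ≠ 0 := by rwa [Ne, ZMod.intCast_zmod_eq_zero_iff_dvd]
  obtain ⟨i, hi⟩ := hg (Units.mk0 _ hq0)
  obtain ⟨j, hj⟩ := hg (Units.mk0 _ hr0)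
  have hi' : (q : ZMod p) = (g : ZMod p) ^ i := by
    rw [← Units.val_pow_eq_pow_val, hi, Units.val_mk0]
  have hj' : (r : ZMod p) = (g : ZMod p) ^ j := by
    rw [← Units.val_pow_eq_pow_val, hj, Units.val_mk0]
  push_cast at hν
  rw [hi', hj', ← pow_add] at hν
  simp only [cube_iff p hp3 g hg ho] at hν
  rw [hi', hj']
  set G : ZMod p := (g : ZMod p) with hG
  have hG0 : G ≠ 0 := g.ne_zero
  let T : ℕ → ℂ := fun n => cubS p (G ^ n)
  have hT3 : ∀ n, T (n + 3) = T n := fun n => by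
    simp only [T]
    rw [pow_add, cubS_mul_cube p _ _ hG0]
  have hTm : ∀ n k, T (n + 3 * k) = T n := by
    intro n k
    induction k with
    | zero => rfl
    | succ k ih => rw [mul_add, mul_one, ← add_assoc, hT3, ih]
  have hTmod : ∀ n, T n = T (n % 3) := fun n => by
    conv_lhs => rw [← Nat.mod_add_div n 3]
    exact hTm _ _
  have hpc : (p : ℂ) ≠ 0 := by exact_mod_cast (by omega : p ≠ 0)
  have hpc1 : (p : ℂ) - 1 ≠ 0 := by
    rw [sub_ne_zero]; exact_mod_cast (by omega : p ≠ 1)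
  -- first moment
  have e1 : T 0 + T 1 + T 2 = 0 := by
    have h := sum_split p g hg (cubS p) hT3
    have h1 := card_eq_sum p 1 (fun _ => 1)
    have hc : Nat.card {x : Fin 1 → ZMod p // ∑ i, (1 : ZMod p) * x i ^ 3 = 0} = 1 := by
      rw [Nat.card_eq_one_iff_unique]
      refine ⟨⟨?_⟩, ⟨0, by simp⟩⟩
      rintro ⟨x, hx⟩ ⟨y, hy⟩
      ext k
      fin_cases k
      simp at hx hy
      simp [hx, hy]
    simp only [hc, Fin.prod_univ_one, mul_one, Nat.cast_one] at h1
    rw [← h1, cubS_zero] at h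
    apply mul_left_cancel₀ hpc1
    simp only [T]
    linear_combination -h
  have e2 : T 0 ^ 2 + T 1 ^ 2 + T 2 ^ 2 = 6 * p := by
    have h := sum_split p g hg (fun t => cubS p t ^ 2) (fun n => by
      exact congrArg (· ^ 2) (hT3 n))
    have h1 := card_eq_sum p 2 (fun _ => 1)
    rw [card_two p hp3 g ho] at h1
    simp only [Fin.prod_univ_two, mul_one, ← sq] at h1
    rw [← h1, cubS_zero] at h
    push_cast [(by omega : 1 ≤ p)] at h
    apply mul_left_cancel₀ hpc1
    simp only [T]
    linear_combination -h
  let a : Fin 4 → ZMod p := ![1, (G ^ i) ^ 2, G ^ i * G ^ j, (G ^ j) ^ 2]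
  have hN := card_eq_sum p 4 a
  have hP := proj_card p a
  have hset : ∀ x : Fin 4 → ZMod p, ∑ k, a k * x k ^ 3 = x 0 ^ 3 + (G ^ i) ^ 2 * x 1 ^ 3
      + G ^ i * G ^ j * x 2 ^ 3 + (G ^ j) ^ 2 * x 3 ^ 3 := by
    intro x
    simp [a, Fin.sum_univ_four]
  rw [hP] at hN
  simp only [hset] at hN
  set M := Nat.card {P : Projectivization (ZMod p) (Fin 4 → ZMod p) //
    P.rep 0 ^ 3 + (G ^ i) ^ 2 * P.rep 1 ^ 3
      + G ^ i * G ^ j * P.rep 2 ^ 3 + (G ^ j) ^ 2 * P.rep 3 ^ 3 = 0} with hM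
  have hval : ∀ n, ∏ k, cubS p (G ^ n * a k)
      = T n * T (n + 2 * i) * T (n + i + j) * T (n + 2 * j) := by
    intro n
    simp only [T, a, Fin.prod_univ_four]
    simp only [Matrix.cons_val]
    congr 2
    · congr 2
      · rw [mul_one]
      · ring
    · ring
    · ring
  have hS := sum_split p g hg (fun t => ∏ k, cubS p (t * a k)) (fun n => by
    change ∏ k, cubS p (G ^ (n + 3) * a k) = ∏ k, cubS p (G ^ n * a k)
    rw [hval, hval, hT3, show n + 3 + 2 * i = n + 2 * i + 3 by ring, hT3,
      show n + 3 + i + j = n + i + j + 3 by ring, hT3,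
      show n + 3 + 2 * j = n + 2 * j + 3 by ring, hT3])
  simp only [← hG, hval] at hS
  rw [← hN] at hS
  simp only [zero_mul, cubS_zero, Fin.prod_univ_four] at hS
  push_cast [(by omega : 1 ≤ p)] at hS
  -- evaluation of the fourth-moment sum
  have key : T 0 * T (0 + 2 * i) * T (0 + i + j) * T (0 + 2 * j)
      + T 1 * T (1 + 2 * i) * T (1 + i + j) * T (1 + 2 * j)
      + T 2 * T (2 + 2 * i) * T (2 + i + j) * T (2 + 2 * j)
      = 9 * (p : ℂ) ^ 2 * (ν - 1) := by
    have e0 : T 2 = -T 0 - T 1 := by linear_combination e1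
    have hpp : (p : ℂ) = (T 0 ^ 2 + T 0 * T 1 + T 1 ^ 2) / 3 := by
      rw [e0] at e2
      linear_combination -e2 / 6
    have hνc : (ν : ℂ) = (if i % 3 = 0 then 1 else 0) + (if j % 3 = 0 then 1 else 0)
        + (if (i + j) % 3 = 0 then 1 else 0) := by exact_mod_cast congrArg (Int.cast : ℤ → ℂ) hν
    rw [hνc, hpp]
    have hi3 : i % 3 = 0 ∨ i % 3 = 1 ∨ i % 3 = 2 := by omega
    have hj3 : j % 3 = 0 ∨ j % 3 = 1 ∨ j % 3 = 2 := by omega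
    have hA : ∀ n k, T (n + 2 * k) = T (n + 2 * (k % 3)) := fun n k => by
      rw [hTmod, hTmod (n + 2 * (k % 3))]
      congr 1
      omega
    have hB : ∀ n, T (n + i + j) = T (n + i % 3 + j % 3) := fun n => by
      rw [hTmod, hTmod (n + i % 3 + j % 3)]
      congr 1
      omega
    have t3 : T 3 = T 0 := hT3 0
    have t4 : T 4 = T 1 := hT3 1
    have t5 : T 5 = T 2 := hT3 2
    have t6 : T 6 = T 0 := (hT3 3).trans t3
    rw [hA 0 i, hA 1 i, hA 2 i, hA 0 j, hA 1 j, hA 2 j, hB 0, hB 1, hB 2, Nat.add_mod i j]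
    clear_value T
    rcases hi3 with h | h | h <;> rcases hj3 with h' | h' | h' <;>
    · rw [h, h']
      norm_num [t3, t4, t5, t6, e0]
      try ring
  rw [key] at hS
  have hfin : (M : ℂ) = (p : ℂ) ^ 2 + (3 * (ν : ℂ) - 2) * p + 1 := by
    apply mul_left_cancel₀ hpc1
    apply mul_left_cancel₀ hpc
    linear_combination hS / 3
  exact_mod_cast hfin
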